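/- Suppose the random walk is non-singular, M_x < 0 or M_y < 0, h(0) < 1 and v(0) < 1; suppose Γ is infinite, every (ρ,σ) ∈ Γ satisfies Q(ρ,σ) = 0, and Γ satisfies the separation condition; suppose the induced measure m is positive, satisfies the interior balance equations, the horizontal balance equations and the vertical balance equations, and that the invariant measure is unique up to scaling. Then p(1,0) = p(1,1) = p(0,1) = 0, and Γ has a unique accumulation point in ℝ², namely the origin: every neighbourhood of (0,0) contains infinitely many points of Γ, and no point of ℝ² other than (0,0) has this property. -/

import Mathlib

open Finset

/-- The index set `{-1, 0, 1}` for the jumps of the random walk. -/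
def II : Finset ℤ := {-1, 0, 1}

/-- The kernel `Q(x,y) = ∑_{s,t ∈ {-1,0,1}} p(s,t) x^{1-s} y^{1-t} − x y`. -/
noncomputable def Qf (p : ℤ → ℤ → ℝ) (x y : ℝ) : ℝ :=
  (∑ s ∈ II, ∑ t ∈ II, p s t * x ^ (1 - s).toNat * y ^ (1 - t).toNat) - x * y

/-- The kernel as an element of the polynomial ring `ℝ[x,y]`;
variable `0` is `x` and variable `1` is `y`. -/
noncomputable def Qpoly (p : ℤ → ℤ → ℝ) : MvPolynomial (Fin 2) ℝ :=
  (∑ s ∈ II, ∑ t ∈ II, MvPolynomial.C (p s t) *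
      MvPolynomial.X 0 ^ (1 - s).toNat * MvPolynomial.X 1 ^ (1 - t).toNat)
    - MvPolynomial.X 0 * MvPolynomial.X 1

/-- The random walk is non-singular if `Q` is irreducible in `ℝ[x,y]`
and of degree 2 in each of the two variables. -/
def Nonsingular (p : ℤ → ℤ → ℝ) : Prop :=
  Irreducible (Qpoly p) ∧ (Qpoly p).degreeOf 0 = 2 ∧ (Qpoly p).degreeOf 1 = 2

/-- Horizontal mean drift. -/
noncomputable def Mx (p : ℤ → ℤ → ℝ) : ℝ := ∑ t ∈ II, (p 1 t - p (-1) t)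

/-- Vertical mean drift. -/
noncomputable def My (p : ℤ → ℤ → ℝ) : ℝ := ∑ s ∈ II, (p s 1 - p s (-1))

/-- The measure on `ℕ × ℕ` induced by the set of geometric terms `Γ`
with coefficients `α`. -/
noncomputable def inducedMeasure (Γ : Set (ℝ × ℝ)) (α : ℝ × ℝ → ℝ) (i j : ℕ) : ℝ :=
  ∑' q : Γ, α q * (q : ℝ × ℝ).1 ^ i * (q : ℝ × ℝ).2 ^ j

/-- The absolute-convergence assumption on the coefficients. -/
def AbsConv (Γ : Set (ℝ × ℝ)) (α : ℝ × ℝ → ℝ) : Prop :=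
  Summable (fun q : Γ => |α q| * (1 - (q : ℝ × ℝ).1)⁻¹ * (1 - (q : ℝ × ℝ).2)⁻¹)

/-- The separation condition on `Γ`. -/
def Separation (Γ : Set (ℝ × ℝ)) : Prop :=
  ∀ q ∈ Γ, ∃ w v : ℕ, 0 < w ∧ 0 < v ∧
    ∀ q' ∈ Γ, q' ≠ q → q'.1 ^ w * q'.2 ^ v ≠ q.1 ^ w * q.2 ^ v

/-- The interior balance equations for a measure `m` on `ℕ × ℕ`. -/
def InteriorBalance (p : ℤ → ℤ → ℝ) (m : ℕ → ℕ → ℝ) : Prop :=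
  ∀ i j : ℕ, 1 ≤ i → 1 ≤ j →
    m i j = ∑ s ∈ II, ∑ t ∈ II, m ((i : ℤ) - s).toNat ((j : ℤ) - t).toNat * p s t

/-- The horizontal balance equations for a measure `m` on `ℕ × ℕ`. -/
def HorizontalBalance (p : ℤ → ℤ → ℝ) (h : ℤ → ℝ) (m : ℕ → ℕ → ℝ) : Prop :=
  ∀ i : ℕ, 1 ≤ i →
    m i 0 = (∑ s ∈ II, m ((i : ℤ) - s).toNat 1 * p s (-1)) +
      ∑ s ∈ II, m ((i : ℤ) - s).toNat 0 * h s

/-- The vertical balance equations for a measure `m` on `ℕ × ℕ`. -/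
def VerticalBalance (p : ℤ → ℤ → ℝ) (v : ℤ → ℝ) (m : ℕ → ℕ → ℝ) : Prop :=
  ∀ j : ℕ, 1 ≤ j →
    m 0 j = (∑ t ∈ II, m 1 ((j : ℤ) - t).toNat * p (-1) t) +
      ∑ t ∈ II, m 0 ((j : ℤ) - t).toNat * v t

/-- Uniqueness of the invariant measure up to scaling. -/
def UniqueInvariant (p : ℤ → ℤ → ℝ) (h v : ℤ → ℝ) (m : ℕ → ℕ → ℝ) : Prop :=
  ∀ m' : ℕ → ℕ → ℝ, (∀ i j, 0 ≤ m' i j) → (∃ i j, m' i j ≠ 0) →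
    Summable (fun ij : ℕ × ℕ => m' ij.1 ij.2) →
    InteriorBalance p m' → HorizontalBalance p h m' → VerticalBalance p v m' →
    ∃ c : ℝ, 0 < c ∧ ∀ i j, m' i j = c * m i j

section GeneralLemmas

/-- A summable combination of powers of distinct bases in `[0, 1]` vanishes only if the
coefficient of every base that occurs exactly once vanishes. -/
lemma coeff_eq_zero_of_tsum_pow_eq_zero {ι : Type*} (b r : ι → ℝ) (hb : Summable b)
    (hr : ∀ i, r i ∈ Set.Icc (0 : ℝ) 1) (hz : ∀ n : ℕ, ∑' i, b i * r i ^ n = 0)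
    (i₀ : ι) (hi : ∀ i, i ≠ i₀ → r i ≠ r i₀) : b i₀ = 0 := by
  classical
  have hpoly : ∀ P : Polynomial ℝ, HasSum (fun i => b i * P.eval (r i)) 0 := by
    intro P
    induction P using Polynomial.induction_on' with
    | add P R hP hR =>
      simpa [mul_add] using hP.add hR
    | monomial n a =>
      have hs : Summable (fun i => b i * r i ^ n) := by
        refine Summable.of_norm_bounded hb.abs fun i => ?_
        rw [Real.norm_eq_abs, abs_mul, abs_pow, abs_of_nonneg (hr i).1]
        exact mul_le_of_le_one_right (abs_nonneg _) (pow_le_one₀ (hr i).1 (hr i).2)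
      have := (hz n ▸ hs.hasSum).mul_left a
      simpa [Polynomial.eval_monomial, mul_left_comm] using this
  have hlim : Filter.Tendsto (fun n : ℕ => ∑' i, b i * (1 - (r i - r i₀) ^ 2) ^ n)
      Filter.atTop (nhds (∑' i, if i = i₀ then b i else 0)) := by
    refine tendsto_tsum_of_dominated_convergence hb.abs (fun i => ?_) ?_
    · by_cases h : i = i₀
      · simp [h]
      · have hne : 0 < (r i - r i₀) ^ 2 := by
          have := sub_ne_zero.2 (hi i h)
          positivity
        have hle : (r i - r i₀) ^ 2 ≤ 1 := by
          have := hr i; have := hr i₀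
          simp only [Set.mem_Icc] at *
          rw [sq_le_one_iff_abs_le_one, abs_le]
          constructor <;> linarith
        have := (tendsto_pow_atTop_nhds_zero_of_lt_one (r := 1 - (r i - r i₀) ^ 2)
          (by linarith) (by linarith)).const_mul (b i)
        simpa [h] using this
    · refine Filter.Eventually.of_forall fun n i => ?_
      have hle : (r i - r i₀) ^ 2 ≤ 1 := by
        have := hr i; have := hr i₀
        simp only [Set.mem_Icc] at *
        rw [sq_le_one_iff_abs_le_one, abs_le]
        constructor <;> linarith
      rw [Real.norm_eq_abs, abs_mul, abs_pow, abs_of_nonneg (by linarith : 0 ≤ 1 - (r i - r i₀) ^ 2)]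
      exact mul_le_of_le_one_right (abs_nonneg _)
        (pow_le_one₀ (by linarith) (by nlinarith [sq_nonneg (r i - r i₀)]))
  have hzero : ∀ n : ℕ, ∑' i, b i * (1 - (r i - r i₀) ^ 2) ^ n = 0 := by
    intro n
    rw [← (hpoly ((1 - (Polynomial.X - Polynomial.C (r i₀)) ^ 2) ^ n)).tsum_eq]
    refine tsum_congr fun i => ?_
    rw [Polynomial.eval_pow, Polynomial.eval_sub, Polynomial.eval_pow]
    simp
  simp only [hzero, tsum_ite_eq] at hlim
  exact (tendsto_nhds_unique hlim tendsto_const_nhds)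

/-- The zero set of a non-degenerate real quadratic is finite. -/
lemma finite_quadratic_roots {a b c : ℝ} (ha : a ≠ 0) :
    {y : ℝ | a * y ^ 2 + b * y + c = 0}.Finite := by
  by_cases h : ∃ y₀ : ℝ, a * y₀ ^ 2 + b * y₀ + c = 0
  · obtain ⟨y₀, h₀⟩ := h
    refine (Set.toFinite {y₀, -b / a - y₀}).subset fun y (hy : _ = _) => ?_
    have hprod : (y - y₀) * (a * (y + y₀) + b) = 0 := by linear_combination hy - h₀
    rcases mul_eq_zero.1 hprod with h | h
    · exact Or.inl (sub_eq_zero.1 h)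
    · right
      rw [Set.mem_singleton_iff]
      field_simp
      linarith
  · push Not at h
    exact Set.Finite.subset Set.finite_empty fun y hy => h y hy

/-- The product of two distinct roots of a quadratic. -/
lemma quadratic_roots_mul {a b c y y' : ℝ} (hy : a * y ^ 2 + b * y + c = 0)
    (hy' : a * y' ^ 2 + b * y' + c = 0) (hne : y ≠ y') : a * (y * y') = c := by
  refine mul_left_cancel₀ (sub_ne_zero.2 hne) ?_
  linear_combination y' * hy - y * hy'

open MvPolynomial in
/-- Properties of an irreducible polynomial in two variables that is quadratic in one of them:
the extreme coefficients do not vanish, and it has finitely many common zeros with an affine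
polynomial having the same leading coefficient. -/
lemma irreducible_quadratic_aux {i j : Fin 2} (hij : i ≠ j) {q : MvPolynomial (Fin 2) ℝ}
    (k B c : Polynomial ℝ)
    (hq : q = Polynomial.aeval (X i) k * X j ^ 2 + Polynomial.aeval (X i) B * X j +
      Polynomial.aeval (X i) c)
    (hirr : Irreducible q) (hdeg : q.degreeOf j = 2) :
    k ≠ 0 ∧ c ≠ 0 ∧ ∀ g : Polynomial ℝ,
      {z : ℝ × ℝ | k.eval z.1 ≠ 0 ∧ k.eval z.1 * z.2 ^ 2 + B.eval z.1 * z.2 + c.eval z.1 = 0 ∧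
        k.eval z.1 * z.2 + g.eval z.1 = 0}.Finite := by
  have hdeg0 : ∀ P : Polynomial ℝ,
      (Polynomial.aeval (X i : MvPolynomial (Fin 2) ℝ) P).degreeOf j = 0 := by
    intro P
    induction P using Polynomial.induction_on' with
    | add P R hP hR =>
      rw [map_add]
      exact Nat.le_zero.1 ((degreeOf_add_le _ _ _).trans (by simp [hP, hR]))
    | monomial n a =>
      rw [Polynomial.aeval_monomial, algebraMap_eq]
      refine Nat.le_zero.1 ((degreeOf_C_mul_le _ _ _).trans ((degreeOf_pow_le _ _ _).trans ?_))
      simp [degreeOf_X_of_ne hij.symm]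
  have hlin : ∀ P R : Polynomial ℝ, (Polynomial.aeval (X i) P * X j +
      Polynomial.aeval (X i) R : MvPolynomial (Fin 2) ℝ).degreeOf j ≤ 1 := by
    intro P R
    refine (degreeOf_add_le _ _ _).trans (max_le ((degreeOf_mul_le _ _ _).trans ?_) ?_)
    · simp [hdeg0]
    · simp [hdeg0]
  have hk : k ≠ 0 := by
    rintro rfl
    have := hlin B c
    rw [hq] at hdeg
    simp at hdeg
    omega
  have hc : c ≠ 0 := by
    rintro rfl
    have hfac : q = X j * (Polynomial.aeval (X i) k * X j + Polynomial.aeval (X i) B) := by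
      rw [hq]; simp; ring
    have hd := hlin k B
    rcases hirr.isUnit_or_isUnit hfac with hu | hu
    · have := (MvPolynomial.isUnit_iff_eq_C_of_isReduced).1 hu
      obtain ⟨a, -, ha⟩ := this
      have := congrArg (degreeOf j) ha
      simp at this
    · obtain ⟨a, -, ha⟩ := (MvPolynomial.isUnit_iff_eq_C_of_isReduced).1 hu
      rw [ha] at hfac
      have := degreeOf_mul_le j (X j) (C a : MvPolynomial (Fin 2) ℝ)
      rw [← hfac, hdeg] at this
      simp at this
  refine ⟨hk, hc, fun g => ?_⟩
  have haff : ∀ R : Polynomial ℝ, ¬ q ∣ Polynomial.aeval (X i) k * X j +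
      Polynomial.aeval (X i) R := by
    rintro R ⟨S, hS⟩
    have hne : Polynomial.aeval (X i : MvPolynomial (Fin 2) ℝ) k * X j +
        Polynomial.aeval (X i) R ≠ 0 := by
      intro h0
      obtain ⟨x, hx⟩ : ∃ x, k.eval x ≠ 0 := by
        by_contra! hx
        exact hk (Polynomial.funext fun x => by simpa using hx x)
      have hev : ∀ y : ℝ, k.eval x * y + R.eval x = 0 := by
        intro y
        have := congrArg (MvPolynomial.aeval (fun l => if l = i then x else y)) h0
        rw [map_add, map_mul, ← Polynomial.aeval_algHom_apply,
          ← Polynomial.aeval_algHom_apply] at this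
        simpa [hij.symm] using this
      apply hx
      linarith [hev 0, hev 1]
    have hS0 : S ≠ 0 := by
      rintro rfl
      exact hne (by simpa using hS)
    have := congrArg (degreeOf j) hS
    rw [degreeOf_mul_eq hirr.ne_zero hS0, hdeg] at this
    have := hlin k R
    omega
  have hres : c * k - g * (B - g) ≠ 0 := by
    intro h0
    have h0' := congrArg (Polynomial.aeval (X i : MvPolynomial (Fin 2) ℝ)) h0
    simp only [map_sub, map_mul, map_zero] at h0'
    have hdvd : q ∣ (Polynomial.aeval (X i) k * X j + Polynomial.aeval (X i) g) *
        (Polynomial.aeval (X i) k * X j + Polynomial.aeval (X i) (B - g)) :=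
      ⟨Polynomial.aeval (X i) k, by rw [hq, map_sub]; linear_combination -h0'⟩
    rcases hirr.prime.dvd_or_dvd hdvd with h | h
    · exact haff _ h
    · exact haff _ h
  refine Set.Finite.subset (((c * k - g * (B - g)).rootSet_finite ℝ).biUnion
    (t := fun x => {z : ℝ × ℝ | z = (x, -g.eval x / k.eval x)}) fun x _ => by simp) ?_
  rintro ⟨x, y⟩ ⟨h1, h2, h3⟩
  simp only at h1 h2 h3
  simp only [Set.mem_iUnion, Set.mem_ofPred_eq, Prod.mk.injEq, exists_prop]
  refine ⟨x, ?_, rfl, ?_⟩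
  · rw [Polynomial.mem_rootSet]
    refine ⟨hres, ?_⟩
    simp
    linear_combination k.eval x * h2 - (k.eval x * y + B.eval x - g.eval x) * h3
  · rw [eq_div_iff h1]
    linarith

end GeneralLemmas

section Kernel

/-- The polynomial `∑ₛ p(s,t) x^{1-s}`, the coefficient of `y^{1-t}` in `Q + x y`. -/
noncomputable def rowPoly (p : ℤ → ℤ → ℝ) (t : ℤ) : Polynomial ℝ :=
  ∑ s ∈ II, Polynomial.C (p s t) * Polynomial.X ^ (1 - s).toNat

/-- The polynomial `∑ₛ h(s) x^{1-s} - x` attached to boundary transition probabilities. -/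
noncomputable def bdryPoly (h : ℤ → ℝ) : Polynomial ℝ :=
  ∑ s ∈ II, Polynomial.C (h s) * Polynomial.X ^ (1 - s).toNat - Polynomial.X

/-- The transition probabilities with the roles of the coordinates exchanged. -/
def transposed (p : ℤ → ℤ → ℝ) : ℤ → ℤ → ℝ := fun s t => p t s

/-- `∑ s p(s,t) x^{1-s} y^{1-t}`, which equals `-x ∂Q/∂x` on the curve `Q = 0`. -/
noncomputable def gradX (p : ℤ → ℤ → ℝ) (x y : ℝ) : ℝ :=
  ∑ s ∈ II, ∑ t ∈ II, p s t * (x ^ (1 - s).toNat * y ^ (1 - t).toNat) * s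

lemma sum_II {M : Type*} [AddCommMonoid M] (f : ℤ → M) :
    ∑ s ∈ II, f s = f (-1) + (f 0 + f 1) := by
  simp [II]

lemma Qf_transposed (p : ℤ → ℤ → ℝ) (x y : ℝ) : Qf (transposed p) x y = Qf p y x := by
  simp [Qf, sum_II, transposed]; ring

lemma Qf_eq_quadratic (p : ℤ → ℤ → ℝ) (x y : ℝ) :
    Qf p x y = (rowPoly p (-1)).eval x * y ^ 2 +
      (rowPoly p 0 - Polynomial.X).eval x * y + (rowPoly p 1).eval x := by
  simp [Qf, sum_II, rowPoly]; ring

lemma Qpoly_eq_quadratic (p : ℤ → ℤ → ℝ) :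
    Qpoly p = Polynomial.aeval (MvPolynomial.X 0) (rowPoly p (-1)) * MvPolynomial.X 1 ^ 2 +
      Polynomial.aeval (MvPolynomial.X 0) (rowPoly p 0 - Polynomial.X) * MvPolynomial.X 1 +
      Polynomial.aeval (MvPolynomial.X 0) (rowPoly p 1) := by
  simp [Qpoly, sum_II, rowPoly, MvPolynomial.algebraMap_eq]; ring

lemma Qpoly_eq_quadratic_transposed (p : ℤ → ℤ → ℝ) :
    Qpoly p = Polynomial.aeval (MvPolynomial.X 1) (rowPoly (transposed p) (-1)) *
        MvPolynomial.X 0 ^ 2 +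
      Polynomial.aeval (MvPolynomial.X 1) (rowPoly (transposed p) 0 - Polynomial.X) *
        MvPolynomial.X 0 +
      Polynomial.aeval (MvPolynomial.X 1) (rowPoly (transposed p) 1) := by
  simp [Qpoly, sum_II, rowPoly, MvPolynomial.algebraMap_eq, transposed]; ring

lemma continuous_Qf (p : ℤ → ℤ → ℝ) : Continuous fun z : ℝ × ℝ => Qf p z.1 z.2 := by
  unfold Qf; fun_prop

variable {p : ℤ → ℤ → ℝ}

lemma rowPoly_eval_pos (hp : ∀ s ∈ II, ∀ t ∈ II, 0 ≤ p s t) {t : ℤ} (ht : t ∈ II)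
    (hne : rowPoly p t ≠ 0) {x : ℝ} (hx : 0 < x) : 0 < (rowPoly p t).eval x := by
  rw [rowPoly, Polynomial.eval_finsetSum]
  have hterm : ∀ s ∈ II,
      0 ≤ (Polynomial.C (p s t) * Polynomial.X ^ (1 - s).toNat).eval x := by
    intro s hs
    have := hp s hs t ht
    simp; positivity
  refine (Finset.sum_nonneg hterm).lt_of_ne fun h0 => hne ?_
  rw [eq_comm, Finset.sum_eq_zero_iff_of_nonneg hterm] at h0
  refine Finset.sum_eq_zero fun s hs => ?_
  have := h0 s hs
  simp only [Polynomial.eval_mul, Polynomial.eval_C, Polynomial.eval_pow, Polynomial.eval_X,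
    mul_eq_zero, (pow_pos hx _).ne', or_false] at this
  simp [this]

lemma gradX_eq (p : ℤ → ℤ → ℝ) (x y : ℝ) : gradX p x y =
    (rowPoly (transposed p) 1).eval y - (rowPoly (transposed p) (-1)).eval y * x ^ 2 := by
  simp [gradX, sum_II, rowPoly, transposed]; ring

lemma gradX_transposed (p : ℤ → ℤ → ℝ) (x y : ℝ) : gradX (transposed p) y x =
    ∑ s ∈ II, ∑ t ∈ II, p s t * (x ^ (1 - s).toNat * y ^ (1 - t).toNat) * t := by
  simp [gradX, sum_II, transposed]; ring

lemma monomial_log_bound {s t : ℤ} (hs : s ∈ II) (ht : t ∈ II) {x y : ℝ} (hx : 0 < x)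
    (hy : 0 < y) :
    x ^ (1 - s).toNat * y ^ (1 - t).toNat * (1 + (s * Real.log x + t * Real.log y)) ≤ x * y ∧
    (x ^ (1 - s).toNat * y ^ (1 - t).toNat * (1 + (s * Real.log x + t * Real.log y)) = x * y →
      x ^ (1 - s).toNat * y ^ (1 - t).toNat = x * y) := by
  have key : x ^ (1 - s).toNat * y ^ (1 - t).toNat *
      Real.exp (s * Real.log x + t * Real.log y) = x * y := by
    have h1 : ∀ (u : ℤ), u ∈ II → ∀ z : ℝ, 0 < z →
        z ^ (1 - u).toNat * Real.exp (u * Real.log z) = z := by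
      intro u hu z hz
      simp only [II, Finset.mem_insert, Finset.mem_singleton] at hu
      rcases hu with rfl | rfl | rfl
      · simp [Real.exp_neg, Real.exp_log hz]; field_simp
      · simp
      · simp [Real.exp_log hz]
    rw [Real.exp_add]
    linear_combination y ^ (1 - t).toNat * Real.exp (t * Real.log y) * h1 s hs x hx +
      x * h1 t ht y hy
  have hM : 0 < x ^ (1 - s).toNat * y ^ (1 - t).toNat := by positivity
  generalize x ^ (1 - s).toNat * y ^ (1 - t).toNat = M at *
  generalize s * Real.log x + t * Real.log y = u at *
  refine ⟨?_, fun h => ?_⟩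
  · rw [← key]
    exact mul_le_mul_of_nonneg_left (by linarith [Real.add_one_le_exp u]) hM.le
  · by_contra hne
    have hu : u ≠ 0 := by rintro rfl; simp at key; exact hne key
    have := mul_lt_mul_of_pos_left (Real.add_one_lt_exp hu) hM
    linarith

lemma sum_log_bound (p : ℤ → ℤ → ℝ) {x y : ℝ} (hQ : Qf p x y = 0) :
    ∑ s ∈ II, ∑ t ∈ II, p s t * (x ^ (1 - s).toNat * y ^ (1 - t).toNat *
      (1 + (s * Real.log x + t * Real.log y))) =
    x * y + Real.log x * gradX p x y + Real.log y * gradX (transposed p) y x := by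
  rw [gradX_transposed]
  simp only [Qf, gradX, sum_II] at *
  linear_combination hQ

/-- Log-convexity of the kernel: the tangent line at a point of the curve `Q = 0` supports the
curve at `(1, 1)`. -/
lemma log_mul_gradX_nonpos (hp : ∀ s ∈ II, ∀ t ∈ II, 0 ≤ p s t)
    (hp1 : ∑ s ∈ II, ∑ t ∈ II, p s t = 1) {x y : ℝ} (hx : 0 < x) (hy : 0 < y)
    (hQ : Qf p x y = 0) :
    Real.log x * gradX p x y + Real.log y * gradX (transposed p) y x ≤ 0 := by
  have h1 := sum_log_bound p hQ
  have h2 : ∑ s ∈ II, ∑ t ∈ II, p s t * (x ^ (1 - s).toNat * y ^ (1 - t).toNat *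
      (1 + (s * Real.log x + t * Real.log y))) ≤ ∑ s ∈ II, ∑ t ∈ II, p s t * (x * y) :=
    Finset.sum_le_sum fun s hs => Finset.sum_le_sum fun t ht =>
      mul_le_mul_of_nonneg_left (monomial_log_bound hs ht hx hy).1 (hp s hs t ht)
  simp only [← Finset.sum_mul, hp1] at h2
  linarith

/-- A critical point of the curve `Q = 0` in the positive quadrant forces zero drift. -/
lemma drift_eq_zero_of_gradX_eq_zero (hp : ∀ s ∈ II, ∀ t ∈ II, 0 ≤ p s t)
    (hp1 : ∑ s ∈ II, ∑ t ∈ II, p s t = 1) {x y : ℝ} (hx : 0 < x) (hy : 0 < y)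
    (hQ : Qf p x y = 0) (h1 : gradX p x y = 0) (h2 : gradX (transposed p) y x = 0) :
    Mx p = 0 ∧ My p = 0 := by
  have hsum := sum_log_bound p hQ
  rw [h1, h2, mul_zero, mul_zero, add_zero, add_zero] at hsum
  have hle : ∀ s ∈ II, ∀ t ∈ II, p s t * (x ^ (1 - s).toNat * y ^ (1 - t).toNat *
      (1 + (s * Real.log x + t * Real.log y))) ≤ p s t * (x * y) := fun s hs t ht =>
    mul_le_mul_of_nonneg_left (monomial_log_bound hs ht hx hy).1 (hp s hs t ht)
  have htot : ∑ s ∈ II, ∑ t ∈ II, p s t * (x * y) = x * y := by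
    simp only [← Finset.sum_mul, hp1, one_mul]
  have heq : ∀ s ∈ II, ∀ t ∈ II,
      p s t * (x ^ (1 - s).toNat * y ^ (1 - t).toNat) = p s t * (x * y) := by
    intro s hs t ht
    have e1 := (Finset.sum_eq_sum_iff_of_le fun s hs =>
      Finset.sum_le_sum (hle s hs)).1 (hsum.trans htot.symm) s hs
    have e2 := (Finset.sum_eq_sum_iff_of_le (hle s hs)).1 e1 t ht
    rcases eq_or_ne (p s t) 0 with h0 | h0
    · simp [h0]
    · rw [(monomial_log_bound hs ht hx hy).2 (mul_left_cancel₀ h0 e2)]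
  have hxy : x * y ≠ 0 := by positivity
  constructor
  · refine (mul_eq_zero.1 (?_ : x * y * Mx p = 0)).resolve_left hxy
    rw [← h1, gradX, Finset.sum_congr rfl fun s hs => Finset.sum_congr rfl fun t ht => by
      rw [heq s hs t ht]]
    simp [Mx, sum_II]; ring
  · refine (mul_eq_zero.1 (?_ : x * y * My p = 0)).resolve_left hxy
    rw [← h2, gradX_transposed, Finset.sum_congr rfl fun s hs =>
      Finset.sum_congr rfl fun t ht => by rw [heq s hs t ht]]
    simp [My, sum_II]; ring

lemma rowPoly_mul_roots {x y y' : ℝ} (h : Qf p x y = 0) (h' : Qf p x y' = 0) (hne : y ≠ y') :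
    (rowPoly p (-1)).eval x * (y * y') = (rowPoly p 1).eval x := by
  rw [Qf_eq_quadratic] at h h'
  exact quadratic_roots_mul h h' hne

lemma gradX_neg_of_left_root (hp : ∀ s ∈ II, ∀ t ∈ II, 0 ≤ p s t)
    (hne : rowPoly (transposed p) (-1) ≠ 0) {x x' y : ℝ} (hx : 0 < x') (hxx : x' < x)
    (hy : 0 < y) (hQ : Qf p x y = 0) (hQ' : Qf p x' y = 0) : gradX p x y < 0 := by
  have hpos := rowPoly_eval_pos (p := transposed p) (fun s hs t ht => hp t ht s hs)
    (t := -1) (by simp [II]) hne hy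
  rw [← Qf_transposed] at hQ hQ'
  rw [gradX_eq, ← rowPoly_mul_roots hQ hQ' hxx.ne']
  have := mul_pos hpos (mul_pos (hx.trans hxx) (sub_pos.2 hxx))
  linarith

/-- A point of the curve `Q = 0` in the open unit square cannot have both another point of the
curve to its left and another one below it. -/
lemma not_corner (hp : ∀ s ∈ II, ∀ t ∈ II, 0 ≤ p s t)
    (hp1 : ∑ s ∈ II, ∑ t ∈ II, p s t = 1)
    (hne : rowPoly p (-1) ≠ 0) (hne' : rowPoly (transposed p) (-1) ≠ 0) {x x' y y' : ℝ}
    (hx : 0 < x') (hxx : x' < x) (hx1 : x < 1) (hy : 0 < y') (hyy : y' < y) (hy1 : y < 1)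
    (hQ : Qf p x y = 0) (hQx : Qf p x' y = 0) (hQy : Qf p x y' = 0) : False := by
  have g1 := gradX_neg_of_left_root hp hne' hx hxx (hy.trans hyy) hQ hQx
  have g2 := gradX_neg_of_left_root (p := transposed p) (fun s hs t ht => hp t ht s hs) hne hy
    hyy (hx.trans hxx) ((Qf_transposed p y x).trans hQ) ((Qf_transposed p y' x).trans hQy)
  have := log_mul_gradX_nonpos hp hp1 (hx.trans hxx) (hy.trans hyy) hQ
  have l1 := Real.log_neg (hx.trans hxx) hx1
  have l2 := Real.log_neg (hy.trans hyy) hy1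
  linarith [mul_pos_of_neg_of_neg l1 g1, mul_pos_of_neg_of_neg l2 g2]

/-- Away from the axes, the distance between the two neighbours of a point of the curve is
bounded below, unless the drift vanishes. -/
lemma exists_step_lower_bound (hp : ∀ s ∈ II, ∀ t ∈ II, 0 ≤ p s t)
    (hp1 : ∑ s ∈ II, ∑ t ∈ II, p s t = 1) (hdrift : Mx p < 0 ∨ My p < 0)
    {δ : ℝ} (hδ : 0 < δ) :
    ∃ ε > 0, ∀ x y x' y' : ℝ, x ∈ Set.Icc δ 1 → y ∈ Set.Icc δ 1 → x' ∈ Set.Icc δ 1 →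
      y' ∈ Set.Icc δ 1 → Qf p x y = 0 → Qf p x' y = 0 → Qf p x y' = 0 → x ≠ x' → y ≠ y' →
      ε ≤ |x' - x| + |y' - y| := by
  set S : Set ((ℝ × ℝ) × (ℝ × ℝ)) :=
    ((Set.Icc δ 1 ×ˢ Set.Icc δ 1) ×ˢ (Set.Icc δ 1 ×ˢ Set.Icc δ 1)) ∩
    {w | Qf p w.1.1 w.1.2 = 0 ∧
      (rowPoly p (-1)).eval w.1.1 * (w.1.2 * w.2.2) = (rowPoly p 1).eval w.1.1 ∧
      (rowPoly (transposed p) (-1)).eval w.1.2 * (w.1.1 * w.2.1) =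
        (rowPoly (transposed p) 1).eval w.1.2} with hS
  have hmem : ∀ x y x' y' : ℝ, x ∈ Set.Icc δ 1 → y ∈ Set.Icc δ 1 → x' ∈ Set.Icc δ 1 →
      y' ∈ Set.Icc δ 1 → Qf p x y = 0 → Qf p x' y = 0 → Qf p x y' = 0 → x ≠ x' → y ≠ y' →
      ((x, y), (x', y')) ∈ S := by
    intro x y x' y' hx hy hx' hy' h0 h1 h2 hxx hyy
    refine ⟨⟨⟨hx, hy⟩, hx', hy'⟩, h0, rowPoly_mul_roots h0 h2 hyy, ?_⟩
    exact rowPoly_mul_roots ((Qf_transposed p y x).trans h0) ((Qf_transposed p y x').trans h1) hxx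
  have hclosed : IsClosed {w : (ℝ × ℝ) × (ℝ × ℝ) | Qf p w.1.1 w.1.2 = 0 ∧
      (rowPoly p (-1)).eval w.1.1 * (w.1.2 * w.2.2) = (rowPoly p 1).eval w.1.1 ∧
      (rowPoly (transposed p) (-1)).eval w.1.2 * (w.1.1 * w.2.1) =
        (rowPoly (transposed p) 1).eval w.1.2} := by
    refine (isClosed_eq ?_ continuous_const).inter
      ((isClosed_eq ?_ ?_).inter (isClosed_eq ?_ ?_))
    · exact (continuous_Qf p).comp continuous_fst
    all_goals fun_prop
  have hcomp : IsCompact S :=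
    ((isCompact_Icc.prod isCompact_Icc).prod (isCompact_Icc.prod isCompact_Icc)).inter_right hclosed
  rcases S.eq_empty_or_nonempty with hE | hne
  · refine ⟨1, one_pos, fun x y x' y' hx hy hx' hy' h0 h1 h2 hxx hyy => ?_⟩
    have := hmem x y x' y' hx hy hx' hy' h0 h1 h2 hxx hyy
    rw [hE] at this
    exact this.elim
  · obtain ⟨⟨⟨x, y⟩, x', y'⟩, hw, hmin⟩ := hcomp.exists_isMinOn hne
      (f := fun w : (ℝ × ℝ) × (ℝ × ℝ) => |w.2.1 - w.1.1| + |w.2.2 - w.1.2|)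
      (by fun_prop)
    refine ⟨|x' - x| + |y' - y|, ?_, fun u v u' v' hx hy hx' hy' h0 h1 h2 hxx hyy =>
      hmin (hmem u v u' v' hx hy hx' hy' h0 h1 h2 hxx hyy)⟩
    obtain ⟨⟨⟨hx, hy⟩, hx', hy'⟩, h0, h1, h2⟩ := hw
    simp only at hx hy hx' hy' h0 h1 h2
    by_contra hle
    have e1 : x' = x := sub_eq_zero.1 (abs_eq_zero.1
      (le_antisymm (by linarith [abs_nonneg (y' - y)]) (abs_nonneg _)))
    have e2 : y' = y := sub_eq_zero.1 (abs_eq_zero.1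
      (le_antisymm (by linarith [abs_nonneg (x' - x)]) (abs_nonneg _)))
    subst e1 e2
    have := drift_eq_zero_of_gradX_eq_zero hp hp1 (hδ.trans_le hx.1) (hδ.trans_le hy.1) h0
      (by rw [gradX_eq]; linarith)
      (by rw [gradX_eq]; change (rowPoly p 1).eval _ - (rowPoly p (-1)).eval _ * _ = 0; linarith)
    rcases hdrift with h | h <;> linarith [this.1, this.2]

end Kernel

section GeometricTerms

/-- If a family of geometric terms satisfies the horizontal balance equations, then a term whose
horizontal base is not shared by another term satisfies them on its own. -/
lemma bdry_eq_zero_of_isolated {ι : Type*} {p : ℤ → ℤ → ℝ} {h : ℤ → ℝ} {m : ℕ → ℕ → ℝ}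
    {a x y : ι → ℝ} (ha : Summable a) (hx : ∀ q, x q ∈ Set.Icc (0 : ℝ) 1)
    (hy : ∀ q, y q ∈ Set.Icc (0 : ℝ) 1) (hm : ∀ i j, m i j = ∑' q, a q * x q ^ i * y q ^ j)
    (hb : HorizontalBalance p h m) (q₀ : ι) (ha₀ : a q₀ ≠ 0)
    (hq : ∀ q, q ≠ q₀ → x q ≠ x q₀) :
    (rowPoly p (-1)).eval (x q₀) * y q₀ + (bdryPoly h).eval (x q₀) = 0 := by
  have hs : ∀ i j : ℕ, HasSum (fun q => a q * x q ^ i * y q ^ j) (m i j) := by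
    intro i j
    rw [hm]
    refine (Summable.of_norm_bounded ha.abs fun q => ?_).hasSum
    rw [mul_assoc, Real.norm_eq_abs, abs_mul, abs_mul, abs_pow, abs_pow, abs_of_nonneg (hx q).1,
      abs_of_nonneg (hy q).1]
    exact mul_le_of_le_one_right (abs_nonneg _) (mul_le_one₀ (pow_le_one₀ (hx q).1 (hx q).2)
      (pow_nonneg (hy q).1 _) (pow_le_one₀ (hy q).1 (hy q).2))
  have hterm : ∀ n : ℕ, HasSum (fun q => a q * ((rowPoly p (-1)).eval (x q) * y q +
      (bdryPoly h).eval (x q)) * x q ^ n) 0 := by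
    intro n
    have hbal := hb (n + 1) (by omega)
    simp only [sum_II, Nat.cast_add, Nat.cast_one, add_sub_cancel_right, sub_neg_eq_add, sub_zero,
      show ((n : ℤ) + 1 + 1).toNat = n + 2 by omega, show ((n : ℤ) + 1).toNat = n + 1 by omega,
      show (n : ℤ).toNat = n by omega] at hbal
    have H := ((((hs (n + 2) 1).mul_left (p (-1) (-1))).add (((hs (n + 1) 1).mul_left
      (p 0 (-1))).add ((hs n 1).mul_left (p 1 (-1))))).add
      (((hs (n + 2) 0).mul_left (h (-1))).add (((hs (n + 1) 0).mul_left (h 0)).add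
      ((hs n 0).mul_left (h 1))))).sub (hs (n + 1) 0)
    convert H using 1
    · rfl
    · funext q
      simp [rowPoly, bdryPoly, sum_II]
      ring
    · linarith
  have hb0 : Summable fun q => a q * ((rowPoly p (-1)).eval (x q) * y q +
      (bdryPoly h).eval (x q)) := by
    simpa using (hterm 0).summable
  exact (mul_eq_zero.1 (coeff_eq_zero_of_tsum_pow_eq_zero _ x hb0 hx
    (fun n => (hterm n).tsum_eq) q₀ hq)).resolve_left ha₀

lemma summable_coeff {Γ : Set (ℝ × ℝ)} {α : ℝ × ℝ → ℝ}
    (hΓU : Γ ⊆ Set.Ioo (0 : ℝ) 1 ×ˢ Set.Ioo (0 : ℝ) 1) (hconv : AbsConv Γ α) :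
    Summable fun q : Γ => α q := by
  refine Summable.of_norm_bounded hconv fun q => ?_
  obtain ⟨⟨h1, h2⟩, h3, h4⟩ := hΓU q.2
  rw [Real.norm_eq_abs, mul_assoc]
  exact le_mul_of_one_le_right (abs_nonneg _) (one_le_mul_of_one_le_of_one_le
    ((one_le_inv₀ (by linarith)).2 (by linarith)) ((one_le_inv₀ (by linarith)).2 (by linarith)))

/-- A planar set whose intersections with axis-parallel lines are finite, in which no point has
both a left and a lower neighbour, and in which all points outside a finite set have neighbours
in both directions at distances bounded below, is finite away from the axes. -/
lemma finite_away_from_axes {Γ E : Set (ℝ × ℝ)} {δ ε : ℝ}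
    (hΓ : ∀ z ∈ Γ, z.1 < 1 ∧ z.2 < 1)
    (hv : ∀ x : ℝ, {z ∈ Γ | z.1 = x}.Finite) (hh : ∀ y : ℝ, {z ∈ Γ | z.2 = y}.Finite)
    (hE : E.Finite)
    (hnv : ∀ z ∈ Γ, z ∉ E → ∃ z' ∈ Γ, z' ≠ z ∧ z'.1 = z.1)
    (hnh : ∀ z ∈ Γ, z ∉ E → ∃ z' ∈ Γ, z' ≠ z ∧ z'.2 = z.2)
    (hcorner : ∀ x y x' y', (x, y) ∈ Γ → (x', y) ∈ Γ → (x, y') ∈ Γ → x' < x → y' < y → False)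
    (hε : 0 < ε)
    (hstep : ∀ x y x' y' : ℝ, (x, y) ∈ Γ → (x', y) ∈ Γ → (x, y') ∈ Γ → δ ≤ x → δ ≤ y → δ ≤ x' →
      δ ≤ y' → x ≠ x' → y ≠ y' → ε ≤ |x' - x| + |y' - y|) :
    {z ∈ Γ | δ ≤ z.1 ∧ δ ≤ z.2}.Finite := by
  set N : Set (ℝ × ℝ) → Set (ℝ × ℝ) :=
    fun F => ⋃ w ∈ F, ({z ∈ Γ | z.1 = w.1} ∪ {z ∈ Γ | z.2 = w.2}) with hN
  have hNfin : ∀ F : Set (ℝ × ℝ), F.Finite → (N F).Finite := fun F hF =>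
    hF.biUnion fun w _ => (hv _).union (hh _)
  have hNv : ∀ {F : Set (ℝ × ℝ)} {z w : ℝ × ℝ}, z ∈ Γ → w ∈ F → z.1 = w.1 → z ∈ N F :=
    fun hz hw h => Set.mem_biUnion hw (Or.inl ⟨hz, h⟩)
  have hNh : ∀ {F : Set (ℝ × ℝ)} {z w : ℝ × ℝ}, z ∈ Γ → w ∈ F → z.2 = w.2 → z ∈ N F :=
    fun hz hw h => Set.mem_biUnion hw (Or.inr ⟨hz, h⟩)
  have hnv' : ∀ x y, (x, y) ∈ Γ → (x, y) ∉ E → ∃ y', (x, y') ∈ Γ ∧ y ≠ y' := by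
    intro x y hz hzE
    obtain ⟨⟨x', y'⟩, h1, h2, rfl⟩ := hnv _ hz hzE
    exact ⟨y', h1, fun h => h2 (by simp [h])⟩
  have hnh' : ∀ x y, (x, y) ∈ Γ → (x, y) ∉ E → ∃ x', (x', y) ∈ Γ ∧ x ≠ x' := by
    intro x y hz hzE
    obtain ⟨⟨x', y'⟩, h1, h2, rfl⟩ := hnh _ hz hzE
    exact ⟨x', h1, fun h => h2 (by simp [h])⟩
  have key : ∀ k : ℕ, {z ∈ Γ | (δ ≤ z.1 ∧ δ ≤ z.2) ∧ 2 - k * ε < z.1 + z.2}.Finite := by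
    intro k
    induction k with
    | zero =>
      refine Set.finite_empty.subset ?_
      rintro z ⟨hz, -, hs⟩
      have := hΓ z hz
      simp at hs
      linarith [this.1, this.2]
    | succ k ih =>
      refine (hE.union ((hNfin E hE).union (hNfin _ (hNfin _ ih)))).subset ?_
      rintro ⟨x, y⟩ ⟨hz, ⟨hx, hy⟩, hs⟩
      push_cast at hs
      simp only at hx hy hs
      by_cases hzE : (x, y) ∈ E
      · exact Or.inl hzE
      right
      obtain ⟨y', hzv, hyy⟩ := hnv' x y hz hzE
      obtain ⟨x', hzh, hxx⟩ := hnh' x y hz hzE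
      rcases lt_or_gt_of_ne hyy with hlt | hlt
      · by_cases hE1 : (x, y') ∈ E
        · exact Or.inl (hNv hz hE1 rfl)
        · obtain ⟨x'', hz2, hne⟩ := hnh' x y' hzv hE1
          rcases lt_or_gt_of_ne hne with hlt' | hlt'
          · right
            have := hstep x y' x'' y hzv hz2 hz hx (by linarith) (by linarith) hy hne hyy.symm
            rw [abs_of_pos (by linarith), abs_of_neg (by linarith)] at this
            refine hNv (w := (x, y')) hz (hNh (w := (x'', y')) hzv
              ⟨hz2, ⟨?_, ?_⟩, ?_⟩ rfl) rfl <;> simp only <;> linarith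
          · exact (hcorner x y' x'' y hzv hz2 hz hlt' hlt).elim
      · rcases lt_or_gt_of_ne hxx with hltx | hltx
        · by_cases hE1 : (x', y) ∈ E
          · exact Or.inl (hNh hz hE1 rfl)
          · obtain ⟨y'', hz2, hne⟩ := hnv' x' y hzh hE1
            rcases lt_or_gt_of_ne hne with hlt' | hlt'
            · right
              have := hstep x' y x y'' hzh hz hz2 (by linarith) hy hx (by linarith) hxx.symm hne
              rw [abs_of_neg (by linarith), abs_of_pos (by linarith)] at this
              refine hNh (w := (x', y)) hz (hNv (w := (x', y'')) hzh
                ⟨hz2, ⟨?_, ?_⟩, ?_⟩ rfl) rfl <;> simp only <;> linarith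
            · exact (hcorner x' y x y'' hzh hz hz2 hltx hlt').elim
        · exact (hcorner x y x' y' hz hzh hzv hltx hlt).elim
  obtain ⟨k, hk⟩ := exists_nat_gt ((2 - 2 * δ) / ε)
  rw [div_lt_iff₀ hε] at hk
  refine (key k).subset ?_
  rintro z ⟨hz, h1, h2⟩
  exact ⟨hz, ⟨h1, h2⟩, by linarith⟩

end GeometricTerms

section AccumulationPoints

variable {p : ℤ → ℤ → ℝ}

/-- The kernel is positive on the positive horizontal axis. -/
lemma Qf_pos_of_axis (hp : ∀ s ∈ II, ∀ t ∈ II, 0 ≤ p s t) (hne : rowPoly p 1 ≠ 0)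
    {x : ℝ} (hx : 0 < x) : 0 < Qf p x 0 := by
  rw [Qf_eq_quadratic]
  simpa using rowPoly_eval_pos hp (t := 1) (by simp [II]) hne hx

/-- If one of the transitions to the east, north-east and north is possible, then the curve `Q = 0`
does not approach the origin within the positive quadrant. -/
lemma Qf_pos_near_origin (hp : ∀ s ∈ II, ∀ t ∈ II, 0 ≤ p s t)
    {x y : ℝ} (hx : 0 < x) (hy : 0 < y)
    (h : x < p 1 0 ∨ y < p 0 1 ∨ x * y < p 1 1) : 0 < Qf p x y := by
  have hmem : (-1 : ℤ) ∈ II ∧ (0 : ℤ) ∈ II ∧ (1 : ℤ) ∈ II := by simp [II]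
  obtain ⟨m, o, e⟩ := hmem
  have h1 := hp _ m _ m
  have h2 := hp _ m _ o
  have h3 := hp _ m _ e
  have h4 := hp _ o _ m
  have h5 := hp _ o _ o
  have h6 := hp _ o _ e
  have h7 := hp _ e _ m
  have h8 := hp _ e _ o
  have h9 := hp _ e _ e
  have hpos : 0 < p 1 1 + p 0 1 * x + p 1 0 * y - x * y := by
    rcases h with h | h | h
    · linarith [mul_lt_mul_of_pos_right h hy, mul_nonneg h6 hx.le]
    · linarith [mul_lt_mul_of_pos_left h hx, mul_nonneg h8 hy.le]
    · linarith [mul_nonneg h6 hx.le, mul_nonneg h8 hy.le]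
  have hrest : 0 ≤ p (-1) 1 * x ^ 2 + p 1 (-1) * y ^ 2 + p 0 0 * (x * y) +
      p (-1) 0 * (x ^ 2 * y) + p 0 (-1) * (x * y ^ 2) + p (-1) (-1) * (x ^ 2 * y ^ 2) := by
    positivity
  have : Qf p x y = (p 1 1 + p 0 1 * x + p 1 0 * y - x * y) + (p (-1) 1 * x ^ 2 +
      p 1 (-1) * y ^ 2 + p 0 0 * (x * y) + p (-1) 0 * (x ^ 2 * y) + p 0 (-1) * (x * y ^ 2) +
      p (-1) (-1) * (x ^ 2 * y ^ 2)) := by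
    simp [Qf, sum_II]; ring
  linarith

lemma finite_fibre {Γ : Set (ℝ × ℝ)} (hp : ∀ s ∈ II, ∀ t ∈ II, 0 ≤ p s t)
    (hne : rowPoly p (-1) ≠ 0) (hΓ : ∀ z ∈ Γ, 0 < z.1 ∧ Qf p z.1 z.2 = 0) (x : ℝ) :
    {z ∈ Γ | z.1 = x}.Finite := by
  by_cases hx : 0 < x
  · have hk := rowPoly_eval_pos hp (t := -1) (by simp [II]) hne hx
    refine ((finite_quadratic_roots (b := (rowPoly p 0 - Polynomial.X).eval x)
      (c := (rowPoly p 1).eval x) hk.ne').image (Prod.mk x)).subset ?_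
    rintro ⟨_, y⟩ ⟨hz, rfl⟩
    exact ⟨y, by have := (hΓ _ hz).2; rwa [Qf_eq_quadratic] at this, rfl⟩
  · refine Set.finite_empty.subset ?_
    rintro z ⟨hz, rfl⟩
    exact hx (hΓ z hz).1

lemma finite_fibre_snd {Γ : Set (ℝ × ℝ)} (hp : ∀ s ∈ II, ∀ t ∈ II, 0 ≤ p s t)
    (hne : rowPoly (transposed p) (-1) ≠ 0) (hΓ : ∀ z ∈ Γ, 0 < z.2 ∧ Qf p z.1 z.2 = 0) (y : ℝ) :
    {z ∈ Γ | z.2 = y}.Finite := by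
  have hfin : {z ∈ Prod.swap '' Γ | z.1 = y}.Finite := by
    refine finite_fibre (p := transposed p) (fun s hs t ht => hp t ht s hs) hne ?_ y
    rintro _ ⟨z, hz, rfl⟩
    exact ⟨(hΓ z hz).1, (Qf_transposed p z.2 z.1).trans (hΓ z hz).2⟩
  refine (hfin.image Prod.swap).subset ?_
  rintro z ⟨hz, rfl⟩
  exact ⟨z.swap, ⟨⟨z, hz, rfl⟩, rfl⟩, z.swap_swap⟩

/-- Points of the curve `Q = 0` in the open unit square that, up to finitely many exceptions, have
companions on the horizontal and vertical lines through them accumulate only on the axes. -/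
lemma finite_curve_points_away_from_axes {Γ E : Set (ℝ × ℝ)}
    (hp : ∀ s ∈ II, ∀ t ∈ II, 0 ≤ p s t)
    (hp1 : ∑ s ∈ II, ∑ t ∈ II, p s t = 1) (hdrift : Mx p < 0 ∨ My p < 0)
    (hk : rowPoly p (-1) ≠ 0) (hkT : rowPoly (transposed p) (-1) ≠ 0)
    (hΓ : ∀ z ∈ Γ, ((0 < z.1 ∧ z.1 < 1) ∧ 0 < z.2 ∧ z.2 < 1) ∧ Qf p z.1 z.2 = 0)
    (hE : E.Finite)
    (hnv : ∀ z ∈ Γ, z ∉ E → ∃ z' ∈ Γ, z' ≠ z ∧ z'.1 = z.1)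
    (hnh : ∀ z ∈ Γ, z ∉ E → ∃ z' ∈ Γ, z' ≠ z ∧ z'.2 = z.2) {δ : ℝ} (hδ : 0 < δ) :
    {z ∈ Γ | δ ≤ z.1 ∧ δ ≤ z.2}.Finite := by
  obtain ⟨ε, hε, hstep⟩ := exists_step_lower_bound hp hp1 hdrift hδ
  have hΓ' : ∀ x y, (x, y) ∈ Γ → ((0 < x ∧ x < 1) ∧ 0 < y ∧ y < 1) ∧ Qf p x y = 0 :=
    fun x y hz => hΓ (x, y) hz
  refine finite_away_from_axes (fun z hz => ⟨(hΓ z hz).1.1.2, (hΓ z hz).1.2.2⟩)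
    (finite_fibre hp hk fun z hz => ⟨(hΓ z hz).1.1.1, (hΓ z hz).2⟩)
    (finite_fibre_snd hp hkT fun z hz => ⟨(hΓ z hz).1.2.1, (hΓ z hz).2⟩) hE hnv hnh ?_ hε ?_
  · intro x y x' y' hz hzx hzy hxx hyy
    have h0 := hΓ' _ _ hz
    have h1 := hΓ' _ _ hzx
    have h2 := hΓ' _ _ hzy
    exact not_corner hp hp1 hk hkT h1.1.1.1 hxx h0.1.1.2 h2.1.2.1 hyy h0.1.2.2 h0.2 h1.2 h2.2
  · intro x y x' y' hz hzx hzy hx hy hx' hy' hxx hyy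
    have h0 := hΓ' _ _ hz
    have h1 := hΓ' _ _ hzx
    have h2 := hΓ' _ _ hzy
    exact hstep x y x' y' ⟨hx, h0.1.1.2.le⟩ ⟨hy, h0.1.2.2.le⟩ ⟨hx', h1.1.1.2.le⟩
      ⟨hy', h2.1.2.2.le⟩ h0.2 h1.2 h2.2 hxx hyy

lemma finite_of_locally_finite {X : Type*} [TopologicalSpace X] {Γ K : Set X} (hK : IsCompact K)
    (hΓ : Γ ⊆ K) (hloc : ∀ q : X, ∃ U ∈ nhds q, (Γ ∩ U).Finite) : Γ.Finite := by
  choose W hW hWfin using hloc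
  obtain ⟨t, -, ht⟩ := hK.elim_nhds_subcover W fun q _ => hW q
  refine (t.finite_toSet.biUnion fun q _ => hWfin q).subset fun z hz => ?_
  obtain ⟨q, hqt, hzq⟩ := Set.mem_iUnion₂.1 (ht (hΓ hz))
  exact Set.mem_biUnion hqt ⟨hz, hzq⟩

end AccumulationPoints

/-- If the induced measure with infinitely many geometric terms is the (unique) invariant
measure, then the random walk has no transitions to the north, northeast or east, and the
set `Γ` has the origin as its unique accumulation point. -/
theorem stmt11 (p : ℤ → ℤ → ℝ)
    (hp : ∀ s ∈ II, ∀ t ∈ II, 0 ≤ p s t)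
    (hp1 : ∑ s ∈ II, ∑ t ∈ II, p s t = 1)
    (h : ℤ → ℝ) (hh : ∀ s ∈ II, 0 ≤ h s)
    (hh1 : h (-1) + h 0 + h 1 + p (-1) 1 + p 0 1 + p 1 1 = 1)
    (v : ℤ → ℝ) (hv : ∀ t ∈ II, 0 ≤ v t)
    (hv1 : v (-1) + v 0 + v 1 + p 1 (-1) + p 1 0 + p 1 1 = 1)
    (hns : Nonsingular p)
    (hdrift : Mx p < 0 ∨ My p < 0)
    (hh0 : h 0 < 1) (hv0 : v 0 < 1)
    (Γ : Set (ℝ × ℝ)) (hΓc : Γ.Countable) (hΓinf : Γ.Infinite)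
    (hΓU : Γ ⊆ Set.Ioo (0 : ℝ) 1 ×ˢ Set.Ioo (0 : ℝ) 1)
    (hΓQ : ∀ q ∈ Γ, Qf p q.1 q.2 = 0)
    (α : ℝ × ℝ → ℝ) (hα : ∀ q ∈ Γ, α q ≠ 0)
    (hconv : AbsConv Γ α)
    (hsep : Separation Γ)
    (hpos : ∀ i j : ℕ, 0 < inducedMeasure Γ α i j)
    (hbi : InteriorBalance p (inducedMeasure Γ α))
    (hbh : HorizontalBalance p h (inducedMeasure Γ α))
    (hbv : VerticalBalance p v (inducedMeasure Γ α))
    (huniq : UniqueInvariant p h v (inducedMeasure Γ α)) :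
    p 1 0 = 0 ∧ p 1 1 = 0 ∧ p 0 1 = 0 ∧
    (∀ U ∈ nhds ((0 : ℝ), (0 : ℝ)), (Γ ∩ U).Infinite) ∧
    (∀ q : ℝ × ℝ, q ≠ (0, 0) → ¬ ∀ U ∈ nhds q, (Γ ∩ U).Infinite) := by
  have hpT : ∀ s ∈ II, ∀ t ∈ II, 0 ≤ transposed p s t := fun s hs t ht => hp t ht s hs
  obtain ⟨hirr, hdegx, hdegy⟩ := hns
  obtain ⟨hk, hc, hfin⟩ := irreducible_quadratic_aux (i := 0) (j := 1) (by decide) _ _ _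
    (Qpoly_eq_quadratic p) hirr hdegy
  obtain ⟨hkT, hcT, hfinT⟩ := irreducible_quadratic_aux (i := 1) (j := 0) (by decide) _ _ _
    (Qpoly_eq_quadratic_transposed p) hirr hdegx
  have hQT : ∀ q ∈ Γ, Qf (transposed p) q.2 q.1 = 0 := fun q hq =>
    (Qf_transposed p q.2 q.1).trans (hΓQ q hq)
  have hmem : ∀ q ∈ Γ, (0 < q.1 ∧ q.1 < 1) ∧ 0 < q.2 ∧ q.2 < 1 := fun q hq => hΓU hq
  set Eh : Set (ℝ × ℝ) := {z ∈ Γ |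
    (rowPoly p (-1)).eval z.1 * z.2 + (bdryPoly h).eval z.1 = 0} with hEh
  set Ev : Set (ℝ × ℝ) := {z ∈ Γ |
    (rowPoly (transposed p) (-1)).eval z.2 * z.1 + (bdryPoly v).eval z.2 = 0} with hEv
  have hEfin : (Eh ∪ Ev).Finite := by
    refine ((hfin (bdryPoly h)).subset ?_).union
      (((hfinT (bdryPoly v)).preimage Prod.swap_injective.injOn).subset ?_)
    · rintro z ⟨hz, hb⟩
      exact ⟨(rowPoly_eval_pos hp (by simp [II]) hk (hmem z hz).1.1).ne',
        (Qf_eq_quadratic p _ _).symm.trans (hΓQ z hz), hb⟩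
    · rintro z ⟨hz, hb⟩
      exact ⟨(rowPoly_eval_pos hpT (by simp [II]) hkT (hmem z hz).2.1).ne',
        (Qf_eq_quadratic (transposed p) _ _).symm.trans (hQT z hz), hb⟩
  have hsum := summable_coeff hΓU hconv
  have hx01 : ∀ q : Γ, (q : ℝ × ℝ).1 ∈ Set.Icc (0 : ℝ) 1 := fun q =>
    ⟨(hmem q q.2).1.1.le, (hmem q q.2).1.2.le⟩
  have hy01 : ∀ q : Γ, (q : ℝ × ℝ).2 ∈ Set.Icc (0 : ℝ) 1 := fun q =>
    ⟨(hmem q q.2).2.1.le, (hmem q q.2).2.2.le⟩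
  have hnv : ∀ z ∈ Γ, z ∉ Eh ∪ Ev → ∃ z' ∈ Γ, z' ≠ z ∧ z'.1 = z.1 := by
    intro z hz hzE
    by_contra! hno
    refine hzE (Or.inl ⟨hz, ?_⟩)
    exact bdry_eq_zero_of_isolated hsum hx01 hy01 (fun i j => rfl) hbh ⟨z, hz⟩ (hα z hz)
      fun q hq => hno q q.2 fun h => hq (Subtype.ext h)
  have hnh : ∀ z ∈ Γ, z ∉ Eh ∪ Ev → ∃ z' ∈ Γ, z' ≠ z ∧ z'.2 = z.2 := by
    intro z hz hzE
    by_contra! hno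
    refine hzE (Or.inr ⟨hz, ?_⟩)
    exact bdry_eq_zero_of_isolated (p := transposed p) (m := fun i j => inducedMeasure Γ α j i)
      hsum hy01 hx01 (fun i j => tsum_congr fun q => mul_right_comm _ _ _) hbv ⟨z, hz⟩ (hα z hz)
      fun q hq => hno q q.2 fun h => hq (Subtype.ext h)
  have hfar : ∀ δ > 0, {z ∈ Γ | δ ≤ z.1 ∧ δ ≤ z.2}.Finite := fun δ hδ =>
    finite_curve_points_away_from_axes hp hp1 hdrift hk hkT (fun z hz => ⟨hmem z hz, hΓQ z hz⟩)
      hEfin hnv hnh hδ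
  have hdisc : ∀ q : ℝ × ℝ, q ≠ (0, 0) → ∃ U ∈ nhds q, (Γ ∩ U).Finite := by
    rintro ⟨x, y⟩ hq
    have hopen : ∀ U : Set (ℝ × ℝ), IsOpen U → (x, y) ∈ U → (∀ z ∈ Γ, z ∉ U) →
        ∃ U ∈ nhds (x, y), (Γ ∩ U).Finite := fun U hU hqU hz =>
      ⟨U, hU.mem_nhds hqU, Set.finite_empty.subset fun z hzU => hz z hzU.1 hzU.2⟩
    rcases lt_trichotomy x 0 with hx | rfl | hx
    · exact hopen {z | z.1 < 0} (isOpen_lt continuous_fst continuous_const) hx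
        fun z hz => not_lt.2 (hmem z hz).1.1.le
    · rcases lt_trichotomy y 0 with hy | rfl | hy
      · exact hopen {z | z.2 < 0} (isOpen_lt continuous_snd continuous_const) hy
          fun z hz => not_lt.2 (hmem z hz).2.1.le
      · exact absurd rfl hq
      · exact hopen {z | 0 < Qf p z.1 z.2} (isOpen_lt continuous_const (continuous_Qf p))
          ((Qf_pos_of_axis hpT hcT hy).trans_eq (Qf_transposed p y 0))
          fun z hz => not_lt.2 (hΓQ z hz).le
    · rcases lt_trichotomy y 0 with hy | rfl | hy
      · exact hopen {z | z.2 < 0} (isOpen_lt continuous_snd continuous_const) hy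
          fun z hz => not_lt.2 (hmem z hz).2.1.le
      · exact hopen {z | 0 < Qf p z.1 z.2} (isOpen_lt continuous_const (continuous_Qf p))
          (Qf_pos_of_axis hp hc hx) fun z hz => not_lt.2 (hΓQ z hz).le
      · refine ⟨{z | min x y / 2 < z.1 ∧ min x y / 2 < z.2}, ?_,
          (hfar (min x y / 2) (half_pos (lt_min hx hy))).subset
            fun z hz => ⟨hz.1, hz.2.1.le, hz.2.2.le⟩⟩
        refine ((isOpen_lt continuous_const continuous_fst).inter
          (isOpen_lt continuous_const continuous_snd)).mem_nhds ⟨?_, ?_⟩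
        · exact (half_lt_self (lt_min hx hy)).trans_le (min_le_left _ _)
        · exact (half_lt_self (lt_min hx hy)).trans_le (min_le_right _ _)
  have horigin : ∀ U ∈ nhds ((0 : ℝ), (0 : ℝ)), (Γ ∩ U).Infinite := by
    intro U hU hUfin
    refine hΓinf (finite_of_locally_finite (isCompact_Icc.prod isCompact_Icc)
      (fun z hz => ⟨hx01 ⟨z, hz⟩, hy01 ⟨z, hz⟩⟩) fun q => ?_)
    by_cases hq : q = (0, 0)
    · exact ⟨U, hq ▸ hU, hUfin⟩
    · exact hdisc q hq
  have hsmall : ∀ V : Set (ℝ × ℝ), IsOpen V → ((0 : ℝ), (0 : ℝ)) ∈ V →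
      (∀ z ∈ V, z.1 < p 1 0 ∨ z.2 < p 0 1 ∨ z.1 * z.2 < p 1 1) → False := by
    intro V hV h0 hlt
    obtain ⟨z, hz, hzV⟩ := (horigin V (hV.mem_nhds h0)).nonempty
    exact (Qf_pos_near_origin hp (hmem z hz).1.1 (hmem z hz).2.1 (hlt z hzV)).ne' (hΓQ z hz)
  have hI : (0 : ℤ) ∈ II ∧ (1 : ℤ) ∈ II := by simp [II]
  refine ⟨?_, ?_, ?_, horigin, fun q hq hall => ?_⟩
  · refine ((hp 1 hI.2 0 hI.1).eq_or_lt.resolve_right fun hlt => ?_).symm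
    exact hsmall {z | z.1 < p 1 0} (isOpen_lt continuous_fst continuous_const) hlt
      fun z hz => Or.inl hz
  · refine ((hp 1 hI.2 1 hI.2).eq_or_lt.resolve_right fun hlt => ?_).symm
    exact hsmall {z | z.1 * z.2 < p 1 1}
      (isOpen_lt (continuous_fst.mul continuous_snd) continuous_const) (by simpa using hlt)
      fun z hz => Or.inr (Or.inr hz)
  · refine ((hp 0 hI.1 1 hI.2).eq_or_lt.resolve_right fun hlt => ?_).symm
    exact hsmall {z | z.2 < p 0 1} (isOpen_lt continuous_snd continuous_const) hlt
      fun z hz => Or.inr (Or.inl hz)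
  · obtain ⟨U, hU, hUfin⟩ := hdisc q hq
    exact hall U hU hUfin
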